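/- The number of isomorphism classes of 4-uniform hypergraphs with exactly 4 hyperedges on 7 vertices having no isolated vertices is 29. Precisely, the action of the symmetric group on Fin 7 on the set of families E of 4-element subsets of Fin 7 with |E| = 4 such that every vertex of Fin 7 lies in at least one member of E has exactly 29 orbits. -/

import Mathlib

/-- Relabeling action: a permutation `σ` sends a family `E` of subsets to `{σ(e) : e ∈ E}`. -/
def permImage {n : ℕ} (σ : Equiv.Perm (Fin n)) (E : Finset (Finset (Fin n))) :
    Finset (Finset (Fin n)) :=
  E.image fun e => e.image σ

lemma permImage_permImage {n : ℕ} (σ τ : Equiv.Perm (Fin n)) (E : Finset (Finset (Fin n))) :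
    permImage τ (permImage σ E) = permImage (τ * σ) E := by
  unfold permImage
  rw [Finset.image_image]
  refine Finset.image_congr ?_
  intro e _
  simp [Function.comp, Finset.image_image]

lemma permImage_one {n : ℕ} (E : Finset (Finset (Fin n))) : permImage 1 E = E := by
  unfold permImage
  simp

/-- The isomorphism (relabeling) setoid on hypergraphs on `Fin n` satisfying a
property `P`: two hypergraphs are isomorphic iff one is obtained from the other by
relabeling the vertices by a permutation. -/
def hypergraphSetoid (n : ℕ) (P : Finset (Finset (Fin n)) → Prop) :
    Setoid {E : Finset (Finset (Fin n)) // P E} where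
  r E F := ∃ σ : Equiv.Perm (Fin n), F.1 = permImage σ E.1
  iseqv := by
    constructor
    · intro E; exact ⟨1, (permImage_one E.1).symm⟩
    · rintro E F ⟨σ, h⟩
      refine ⟨σ⁻¹, ?_⟩
      rw [h, permImage_permImage]
      simp [permImage_one]
    · rintro E F G ⟨σ, h⟩ ⟨τ, h'⟩
      exact ⟨τ * σ, by rw [h', h, permImage_permImage]⟩

namespace SevenVertexHypergraph

open Finset

/-- The `i`-th binary digit of a mask. -/
def bit (i m : ℕ) : ℕ := m / 2 ^ i % 2

/-- The hypergraph whose `i`-th edge consists of the vertices `v` such that bit `i` of the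
mask `t v` is set. -/
def ofMasks (t : Fin 7 → ℕ) : Finset (Finset (Fin 7)) :=
  univ.image fun i : Fin 4 => univ.filter fun v => bit i (t v) = 1

lemma ofMasks_eq_permImage (t : Fin 7 → ℕ) (σ : Equiv.Perm (Fin 7)) :
    ofMasks t = permImage σ (ofMasks (t ∘ σ)) := by
  unfold ofMasks permImage
  rw [image_image]
  refine image_congr fun i _ => ?_
  ext v
  simp only [mem_filter, mem_univ, true_and, Function.comp_apply, mem_image]
  exact ⟨fun h => ⟨σ.symm v, by simpa using h, by simp⟩, by rintro ⟨w, hw, rfl⟩; exact hw⟩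

/-- The value at `m` of the function on masks tabulated by the base 16 digits of `T`. -/
def permBits (T m : ℕ) : ℕ := T / 16 ^ m % 16

/-- Tables of the actions on masks of all permutations of the four edge labels. -/
def bitPerms : List ℕ :=
  [18364758544493064720, 18364683486789906960, 18355225778678027280, 18355113192123290640,
    18336085189344794640, 18336047660493215760, 18297203519274627360, 18297128461571469600,
    18282904370552071200, 18282773019571545120, 18263763781218838560, 18263707487941470240,
    18152560703022715200, 18152448116467978560, 18147794320115196480, 18147662969134670400,
    18119083436115347520, 18119064671689558080, 17863200012815733120, 17863162483964154240,
    17858433629908214400, 17858377336630846080, 17848863335241598080, 17848844570815808640]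

lemma exists_bit_permBits_of_mem_bitPerms : ∀ T ∈ bitPerms,
    (∀ i : Fin 4, ∃ j : Fin 4, ∀ m < 16, bit j (permBits T m) = bit i m) ∧
    (∀ j : Fin 4, ∃ i : Fin 4, ∀ m < 16, bit j (permBits T m) = bit i m) := by
  decide +kernel

lemma ofMasks_permBits {T : ℕ} (hT : T ∈ bitPerms) {t : Fin 7 → ℕ}
    (ht : ∀ v, t v < 16) : ofMasks (permBits T ∘ t) = ofMasks t := by
  obtain ⟨h₁, h₂⟩ := exists_bit_permBits_of_mem_bitPerms T hT
  ext e
  simp only [ofMasks, mem_image, mem_univ, true_and, Function.comp_apply]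
  constructor
  · rintro ⟨j, rfl⟩
    obtain ⟨i, hi⟩ := h₂ j
    exact ⟨i, by simp only [hi _ (ht _)]⟩
  · rintro ⟨i, rfl⟩
    obtain ⟨j, hj⟩ := h₁ i
    exact ⟨j, by simp only [hj _ (ht _)]⟩

/-- Mask lists, one for each isomorphism class. -/
def representatives : List (List ℕ) :=
  [[1, 1, 6, 10, 12, 15, 15], [1, 1, 6, 10, 13, 14, 15], [1, 1, 6, 11, 13, 14, 14],
    [1, 2, 4, 8, 15, 15, 15], [1, 2, 4, 9, 14, 15, 15], [1, 2, 4, 11, 13, 14, 15],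
    [1, 2, 5, 9, 14, 14, 15], [1, 2, 5, 10, 12, 15, 15], [1, 2, 5, 10, 13, 14, 15],
    [1, 2, 5, 11, 12, 14, 15], [1, 2, 5, 11, 13, 14, 14], [1, 2, 7, 11, 12, 12, 15],
    [1, 2, 7, 11, 12, 13, 14], [1, 3, 5, 9, 14, 14, 14], [1, 3, 5, 10, 12, 14, 15],
    [1, 3, 5, 10, 13, 14, 14], [1, 3, 6, 10, 12, 13, 15], [1, 3, 6, 10, 13, 13, 14],
    [1, 3, 6, 11, 12, 12, 15], [1, 3, 6, 11, 12, 13, 14], [1, 3, 7, 11, 12, 12, 14],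
    [1, 6, 6, 10, 11, 13, 13], [1, 6, 7, 10, 11, 12, 13], [3, 3, 5, 9, 12, 14, 14],
    [3, 3, 5, 10, 12, 12, 15], [3, 3, 5, 10, 12, 13, 14], [3, 3, 5, 11, 12, 12, 14],
    [3, 5, 6, 9, 10, 12, 15], [3, 5, 6, 9, 10, 13, 14]]

/-- The hypergraph encoded by a list of masks. -/
def ofList (r : List ℕ) : Finset (Finset (Fin 7)) :=
  ofMasks fun v => r.getD v 0

lemma map_getD_of_mem_representatives : ∀ r ∈ representatives,
    (univ : Finset (Fin 7)).val.map (fun v : Fin 7 => r.getD v 0) = (r : Multiset ℕ) := by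
  decide +kernel

lemma bounds_of_mem_representatives :
    ∀ r ∈ representatives, r.length < 8 ∧ ∀ m ∈ r, m < 16 := by
  decide +kernel

lemma ofList_spec : ∀ r ∈ representatives, (ofList r).card = 4 ∧
    (∀ e ∈ ofList r, e.card = 4) ∧ ∀ v : Fin 7, ∃ e ∈ ofList r, v ∈ e := by
  decide +kernel

/-- An isomorphism invariant: the sum over ordered pairs of edges of the squared sum of
squared vertex degrees in their intersection. -/
def pairInvariant (E : Finset (Finset (Fin 7))) : ℕ :=
  ∑ e ∈ E, ∑ f ∈ E, (∑ v ∈ e ∩ f, (E.filter (v ∈ ·)).card ^ 2) ^ 2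

lemma pairInvariant_permImage (σ : Equiv.Perm (Fin 7)) (E : Finset (Finset (Fin 7))) :
    pairInvariant (permImage σ E) = pairInvariant E := by
  have hinj : Function.Injective fun e : Finset (Fin 7) => e.image σ :=
    image_injective σ.injective
  have hdeg (v : Fin 7) :
      ((permImage σ E).filter (σ v ∈ ·)).card = (E.filter (v ∈ ·)).card := by
    rw [permImage, filter_image, card_image_of_injective _ hinj]
    simp
  unfold pairInvariant
  simp only [show permImage σ E = E.image fun e => e.image σ from rfl] at hdeg ⊢
  rw [sum_image hinj.injOn]
  refine sum_congr rfl fun e _ => ?_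
  rw [sum_image hinj.injOn]
  refine sum_congr rfl fun f _ => ?_
  rw [← image_inter _ _ σ.injective, sum_image σ.injective.injOn]
  simp only [hdeg]

lemma map_pairInvariant_representatives :
    (representatives.map fun r => pairInvariant (ofList r)) =
    [19876, 13394, 8474, 37252, 23696, 16210, 13786, 19858, 13376, 13202, 8282, 13092, 7698,
      7522, 10618, 6528, 10444, 6354, 10508, 5944, 6008, 6244, 5770, 4740, 8064, 4330, 4394, 7936,
      4266] := by
  decide +kernel

lemma eq_of_pairInvariant_eq {r s : List ℕ} (hr : r ∈ representatives)
    (hs : s ∈ representatives)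
    (h : pairInvariant (ofList r) = pairInvariant (ofList s)) : r = s := by
  have hnodup : (representatives.map fun r => pairInvariant (ofList r)).Nodup := by
    rw [map_pairInvariant_representatives]
    decide
  exact List.inj_on_of_nodup_map hnodup hr hs h

/-- A multiset of small masks encoded by a number whose base 8 digits are the
multiplicities. -/
def code (M : Multiset ℕ) : ℕ := (M.map (8 ^ ·)).sum

lemma eq_of_sum_mul_eight_pow_eq (n : ℕ) : ∀ f g : ℕ → ℕ, (∀ i, f i < 8) → (∀ i, g i < 8) →
    ∑ i ∈ range n, f i * 8 ^ i = ∑ i ∈ range n, g i * 8 ^ i → ∀ i < n, f i = g i := by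
  induction n with
  | zero => simp
  | succ n ih =>
    intro f g hf hg h
    simp only [sum_range_succ', pow_succ, ← mul_assoc, ← sum_mul, pow_zero, mul_one] at h
    have h0 : f 0 = g 0 := by have := hf 0; have := hg 0; omega
    have hs := ih (fun i => f (i + 1)) (fun i => g (i + 1)) (fun i => hf _) (fun i => hg _)
      (by omega)
    rintro (_ | i) hi
    · exact h0
    · exact hs i (by omega)

lemma code_eq_sum_count {M : Multiset ℕ} (hM : ∀ m ∈ M, m < 16) :
    code M = ∑ i ∈ range 16, M.count i * 8 ^ i := by
  rw [code, Finset.sum_multiset_map_count]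
  refine sum_subset (fun m hm => by simpa using hM m (by simpa using hm)) fun m _ hm => ?_
  rw [Multiset.count_eq_zero_of_notMem (by simpa using hm), zero_smul]

lemma eq_of_code_eq {M N : Multiset ℕ} (hM : ∀ m ∈ M, m < 16) (hN : ∀ m ∈ N, m < 16)
    (hM' : M.card < 8) (hN' : N.card < 8) (h : code M = code N) : M = N := by
  rw [code_eq_sum_count hM, code_eq_sum_count hN] at h
  have hcount := eq_of_sum_mul_eight_pow_eq 16 (M.count ·) (N.count ·)
    (fun i => (M.count_le_card i).trans_lt hM') (fun i => (N.count_le_card i).trans_lt hN') h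
  ext m
  by_cases hm : m < 16
  · exact hcount m hm
  · rw [Multiset.count_eq_zero_of_notMem fun h => hm (hM m h),
      Multiset.count_eq_zero_of_notMem fun h => hm (hN m h)]

/-- The codes of the representatives. -/
def representativeCodes : List ℕ :=
  [70438537658384, 40133248417808, 9354439032848, 105553133047880, 74766924910664,
    40140764352584, 43980599361608, 70438537429064, 40133248188488, 39659728044104, 9354438803528,
    35330403074120, 5025113833544, 13194273784328, 39652211851784, 9346922611208, 35803921383944,
    5498632143368, 35330401239560, 5025111998984, 4544077496840, 1109175828488, 628141326344,
    8864946750464, 35322884817920, 5017595577344, 4544075432960, 35254299820544, 4949010579968]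

lemma representativeCodes_eq :
    representativeCodes = representatives.map fun r : List ℕ => code r := by
  decide +kernel

/-- Two of the edges encoded by the masks coincide. -/
def hasRepeatedEdge (l : List ℕ) : Bool :=
  [(0, 1), (0, 2), (0, 3), (1, 2), (1, 3), (2, 3)].any fun q =>
    l.all fun m => (bit q.1 m).beq (bit q.2 m)

/-- Some permutation of the edge labels yields the code of a representative. -/
def isReducible (l : List ℕ) : Bool :=
  bitPerms.any fun T =>
    representativeCodes.any ((l.map fun m => 8 ^ permBits T m).sum.beq ·)

/-- Checks that every extension of `acc` by `n` masks from the given list whose bits sum to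
`a`, `b`, `c`, `d` has a repeated edge or is reducible. The masks have to be listed in
order of decreasing number of bits. -/
def search : List ℕ → ℕ → ℕ → ℕ → ℕ → ℕ → List ℕ → Bool
  | [], a, b, c, d, n, acc =>
      !(a + b + c + d + n).beq 0 || (hasRepeatedEdge acc || isReducible acc)
  | m :: ms, a, b, c, d, n, acc =>
      !(a + b + c + d).ble (n * (bit 0 m + bit 1 m + bit 2 m + bit 3 m)) ||
      (List.range (n + 1)).all fun k =>
        !(k * bit 0 m).ble a || (!(k * bit 1 m).ble b || (!(k * bit 2 m).ble c ||
        (!(k * bit 3 m).ble d ||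
          search ms (a - k * bit 0 m) (b - k * bit 1 m) (c - k * bit 2 m) (d - k * bit 3 m)
            (n - k) (List.replicate k m ++ acc))))

/-- The nonzero masks, in order of decreasing number of bits. -/
def masks : List ℕ := [15, 14, 13, 11, 7, 12, 10, 9, 6, 5, 3, 8, 4, 2, 1]

lemma search_masks : search masks 4 4 4 4 7 [] = true := by
  decide +kernel

lemma search_sound (ms : List ℕ)
    (hms : ms.Pairwise fun x y => bit 0 y + bit 1 y + bit 2 y + bit 3 y ≤
      bit 0 x + bit 1 x + bit 2 x + bit 3 x) :
    ∀ (a b c d n : ℕ) (acc : List ℕ), search ms a b c d n acc = true →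
    ∀ R : Multiset ℕ, (∀ m ∈ R, m ∈ ms) → (R.map (bit 0)).sum = a → (R.map (bit 1)).sum = b →
    (R.map (bit 2)).sum = c → (R.map (bit 3)).sum = d → R.card = n →
    ∃ l : List ℕ, (l : Multiset ℕ) = R + acc ∧
      (hasRepeatedEdge l = true ∨ isReducible l = true) := by
  induction ms with
  | nil =>
    rintro a b c d n acc h R hR rfl rfl rfl rfl rfl
    obtain rfl : R = 0 := Multiset.eq_zero_of_forall_notMem fun m hm => by simpa using hR m hm
    exact ⟨acc, by simp, by simpa [search] using h⟩
  | cons m ms ih =>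
    rintro a b c d n acc h R hR ha hb hc hd hn
    obtain ⟨hm, hms⟩ := List.pairwise_cons.1 hms
    have hle : a + b + c + d ≤ n * (bit 0 m + bit 1 m + bit 2 m + bit 3 m) := by
      have := Multiset.sum_le_card_nsmul
        (R.map fun x => bit 0 x + bit 1 x + bit 2 x + bit 3 x)
        (bit 0 m + bit 1 m + bit 2 m + bit 3 m) (by
          simp only [Multiset.mem_map]
          rintro _ ⟨x, hx, rfl⟩
          rcases List.mem_cons.1 (hR x hx) with rfl | hx
          · exact le_rfl
          · exact hm x hx)
      simpa only [Multiset.sum_map_add, Multiset.card_map, smul_eq_mul, ha, hb, hc, hd, hn]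
        using this
    set k := R.count m
    set S := R.filter (· ≠ m)
    have hRS : R = Multiset.replicate k m + S := by
      rw [← Multiset.filter_eq', Multiset.filter_add_not]
    have hsum (i : ℕ) :
        (R.map (bit i)).sum = k * bit i m + (S.map (bit i)).sum := by
      rw [hRS]
      simp
    have hcard : R.card = k + S.card := by
      rw [hRS]
      simp
    rw [hsum] at ha hb hc hd
    rw [hcard] at hn
    simp only [search, Bool.or_eq_true, Bool.not_eq_true', ← Bool.not_eq_true, Nat.ble_eq,
      List.all_eq_true, List.mem_range] at h
    have h := (h.resolve_left (not_not.2 hle)) k (by omega)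
    have h := (((h.resolve_left (by omega)).resolve_left (by omega)).resolve_left
      (by omega)).resolve_left (by omega)
    obtain ⟨l, hl, hl'⟩ := ih hms _ _ _ _ _ _ h S
      (fun x hx => by
        obtain ⟨hx, hne⟩ := Multiset.mem_filter.1 hx
        exact (List.mem_cons.1 (hR x hx)).resolve_left hne)
      (by omega) (by omega) (by omega) (by omega) (by omega)
    refine ⟨l, ?_, hl'⟩
    rw [hl, hRS, ← Multiset.coe_add, Multiset.coe_replicate]
    abel

lemma exists_representative {R : Multiset ℕ} (hR : ∀ m ∈ R, m ∈ masks)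
    (hbit : ∀ i : Fin 4, (R.map (bit i)).sum = 4) (hcard : R.card = 7)
    (hne : ∀ i j : Fin 4, i ≠ j → ∃ m ∈ R, bit i m ≠ bit j m) :
    ∃ T ∈ bitPerms, ∃ r : List ℕ, r ∈ representatives ∧ R.map (permBits T) = r := by
  obtain ⟨l, hl, h⟩ := search_sound masks (by decide) _ _ _ _ _ _ search_masks R hR (hbit 0)
    (hbit 1) (hbit 2) (hbit 3) hcard
  obtain rfl : (l : Multiset ℕ) = R := by simpa using hl
  rcases h with h | h
  · simp only [hasRepeatedEdge, List.any_eq_true, List.all_eq_true, Nat.beq_eq] at h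
    obtain ⟨q, hq, h⟩ := h
    have hlt : ∀ q ∈ [(0, 1), (0, 2), (0, 3), (1, 2), (1, 3), (2, 3)],
        q.1 < 4 ∧ q.2 < 4 ∧ q.1 ≠ q.2 := by decide
    obtain ⟨h₁, h₂, h₁₂⟩ := hlt q hq
    obtain ⟨m, hm, hne⟩ := hne ⟨q.1, h₁⟩ ⟨q.2, h₂⟩ (by simpa using h₁₂)
    exact absurd (h m hm) hne
  · simp only [isReducible, List.any_eq_true, Nat.beq_eq, representativeCodes_eq,
      List.mem_map] at h
    obtain ⟨T, hT, _, ⟨r, hr, rfl⟩, h⟩ := h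
    refine ⟨T, hT, r, hr, eq_of_code_eq ?_ ?_ ?_ ?_ ?_⟩
    · intro x hx
      obtain ⟨m, -, rfl⟩ := Multiset.mem_map.1 hx
      exact Nat.mod_lt _ (by norm_num)
    · exact (bounds_of_mem_representatives r hr).2
    · rw [Multiset.card_map, hcard]
      norm_num
    · exact (bounds_of_mem_representatives r hr).1
    · rw [← h, code, Multiset.map_map, Multiset.map_coe, Multiset.sum_coe]
      rfl

lemma exists_perm_of_map_univ_eq {α β : Type*} [Fintype α] {f g : α → β}
    (h : (univ : Finset α).val.map f = univ.val.map g) :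
    ∃ σ : Equiv.Perm α, g ∘ σ = f := by
  classical
  have hcard (c : β) : Fintype.card {a // f a = c} = Fintype.card {a // g a = c} := by
    have hc := congrArg (Multiset.count c) h
    simp only [Multiset.count_map, eq_comm (a := c)] at hc
    rwa [Fintype.card_subtype, Fintype.card_subtype]
  refine ⟨Equiv.ofFiberEquiv fun c => Fintype.equivOfCardEq (hcard c), funext fun a => ?_⟩
  exact Equiv.ofFiberEquiv_map _ a

/-- The mask with prescribed bits. -/
def maskOf (b : Fin 4 → Bool) : ℕ := ∑ i, (b i).toNat * 2 ^ (i : ℕ)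

lemma bit_maskOf : ∀ (b : Fin 4 → Bool) (i : Fin 4), bit i (maskOf b) = (b i).toNat := by
  decide +kernel

lemma maskOf_mem_masks : ∀ b : Fin 4 → Bool, (∃ i, b i = true) → maskOf b ∈ masks := by
  decide +kernel

lemma lt_of_mem_masks : ∀ m ∈ masks, m < 16 := by
  decide

lemma exists_permImage_ofList {E : Finset (Finset (Fin 7))} (hE : E.card = 4)
    (hcard : ∀ e ∈ E, e.card = 4) (hcover : ∀ v : Fin 7, ∃ e ∈ E, v ∈ e) :
    ∃ r ∈ representatives, ∃ σ : Equiv.Perm (Fin 7), E = permImage σ (ofList r) := by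
  let e : Fin 4 ≃ E := (E.equivFinOfCardEq hE).symm
  let t : Fin 7 → ℕ := fun v => maskOf fun i => decide (v ∈ (e i).1)
  have hbit (i : Fin 4) (v : Fin 7) : bit i (t v) = if v ∈ (e i).1 then 1 else 0 := by
    rw [bit_maskOf]
    by_cases h : v ∈ (e i).1 <;> simp [h]
  have htE : ofMasks t = E := by
    ext s
    simp only [ofMasks, mem_image, mem_univ, true_and, hbit]
    constructor
    · rintro ⟨i, rfl⟩
      simp
    · intro hs
      exact ⟨e.symm ⟨s, hs⟩, by simp⟩
  have hmasks (v : Fin 7) : t v ∈ masks := by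
    refine maskOf_mem_masks _ ?_
    obtain ⟨s, hs, hv⟩ := hcover v
    exact ⟨e.symm ⟨s, hs⟩, by simpa using hv⟩
  obtain ⟨T, hT, r, hr, h⟩ := exists_representative
    (R := (univ : Finset (Fin 7)).val.map t)
    (by simpa only [Multiset.mem_map, mem_val, mem_univ, true_and, forall_exists_index,
      forall_apply_eq_imp_iff] using hmasks)
    (fun i => by
      rw [Multiset.map_map]
      change ∑ v, bit i (t v) = 4
      simp [hbit, hcard])
    (by simp)
    (fun i j hij => by
      by_contra! hcon
      refine hij (e.injective (Subtype.ext (Finset.ext fun v => ?_)))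
      have := hcon (t v) (Multiset.mem_map_of_mem t (mem_univ v))
      rw [hbit, hbit] at this
      by_cases h₁ : v ∈ (e i).1 <;> by_cases h₂ : v ∈ (e j).1 <;> simp_all)
  rw [← map_getD_of_mem_representatives r hr, Multiset.map_map] at h
  obtain ⟨σ, hσ⟩ := exists_perm_of_map_univ_eq h.symm
  refine ⟨r, hr, σ, ?_⟩
  rw [← htE, ← ofMasks_permBits hT fun v => lt_of_mem_masks _ (hmasks v),
    ofMasks_eq_permImage _ σ, ofList]
  rw [hσ]

end SevenVertexHypergraph

/-- There are exactly 29 isomorphism classes of 4-uniform hypergraphs with 4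
hyperedges on 7 vertices with no isolated vertices. -/
theorem card_hypergraph_classes_seven_vertices_no_isolated :
    Nat.card (Quotient (hypergraphSetoid 7 fun E =>
      E.card = 4 ∧ (∀ e ∈ E, e.card = 4) ∧ ∀ v : Fin 7, ∃ e ∈ E, v ∈ e)) = 29 := by
  let P : Finset (Finset (Fin 7)) → Prop := fun E =>
    E.card = 4 ∧ (∀ e ∈ E, e.card = 4) ∧ ∀ v : Fin 7, ∃ e ∈ E, v ∈ e
  let φ : {r // r ∈ SevenVertexHypergraph.representatives.toFinset} →
      Quotient (hypergraphSetoid 7 P) := fun r =>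
    Quotient.mk _ ⟨SevenVertexHypergraph.ofList r,
      SevenVertexHypergraph.ofList_spec r (List.mem_toFinset.1 r.2)⟩
  have hφ : Function.Bijective φ := by
    constructor
    · intro r s h
      obtain ⟨σ, hσ⟩ := Quotient.exact h
      refine Subtype.ext (SevenVertexHypergraph.eq_of_pairInvariant_eq
        (List.mem_toFinset.1 r.2) (List.mem_toFinset.1 s.2) ?_)
      rw [show SevenVertexHypergraph.ofList s = _ from hσ,
        SevenVertexHypergraph.pairInvariant_permImage]
    · intro q
      obtain ⟨⟨E, hE, hcard, hcover⟩, rfl⟩ := Quotient.exists_rep q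
      obtain ⟨r, hr, σ, hσ⟩ :=
        SevenVertexHypergraph.exists_permImage_ofList hE hcard hcover
      exact ⟨⟨r, List.mem_toFinset.2 hr⟩, Quotient.sound ⟨σ, hσ⟩⟩
  rw [← Nat.card_eq_of_bijective φ hφ, Nat.card_eq_fintype_card, Fintype.card_coe]
  decide +kernel
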